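/- arXiv:math/0303294 — 5 statements merged into one kernel-verified Lean document; each statement's English description precedes it below -/
import Mathlib

section
/- Let Q be a preorder whose universe is a set of countable ordinals, and let P be a suborder of Q such that every subset of P that is predense in P is predense in Q. Then there is a club E ⊆ ω₁ such that for every δ ∈ E, every set X ⊆ P ∩ δ that is predense in P↾δ is predense in Q↾δ. -/
namespace Stmt1

/-- The first uncountable ordinal. -/
noncomputable def omega1 : Ordinal := (Cardinal.aleph 1).ord

/-- `C` is a club subset of `ω₁`: unbounded in `ω₁` and closed under suprema of its
bounded nonempty subsets. -/
def IsClub (C : Set Ordinal) : Prop :=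
  C ⊆ Set.Iio omega1 ∧
  (∀ α < omega1, ∃ β ∈ C, α ≤ β) ∧
  ∀ s ⊆ C, s.Nonempty → sSup s < omega1 → sSup s ∈ C

/-- A preorder whose universe is a set of ordinals. -/
structure OrdPreorder where
  carrier : Set Ordinal
  le : Ordinal → Ordinal → Prop
  refl : ∀ p ∈ carrier, le p p
  trans : ∀ p q r : Ordinal, le p q → le q r → le p r

/-- `p` and `q` are compatible within the subset `A` of the universe. -/
def OrdPreorder.CompatIn (P : OrdPreorder) (A : Set Ordinal) (p q : Ordinal) : Prop :=
  ∃ r ∈ A, P.le p r ∧ P.le q r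

/-- `X` is predense in the suborder with universe `A`. -/
def OrdPreorder.PredenseIn (P : OrdPreorder) (A X : Set Ordinal) : Prop :=
  ∀ p ∈ A, ∃ x ∈ X, P.CompatIn A x p

theorem lt_omega1_iff {α : Ordinal} : α < omega1 ↔ α < Ordinal.omega 1 := by
  rw [omega1, Cardinal.ord_aleph]

theorem countable_Iio_of_lt_omega1 {α : Ordinal} (h : α < omega1) :
    (Set.Iio α).Countable := by
  rw [← Cardinal.le_aleph0_iff_set_countable, Cardinal.mk_Iio_ordinal, Cardinal.lift_le_aleph0,
    ← Order.lt_succ_iff, Cardinal.succ_aleph0]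
  exact Cardinal.lt_ord.1 h

theorem iSup_lt_omega1 {ι : Type*} [Countable ι] {f : ι → Ordinal} (h : ∀ i, f i < omega1) :
    ⨆ i, f i < omega1 := by
  rw [lt_omega1_iff]
  exact Ordinal.iSup_lt_omega_one fun i => lt_omega1_iff.1 (h i)

theorem succ_lt_omega1 {α : Ordinal} (h : α < omega1) : Order.succ α < omega1 :=
  (Cardinal.isSuccLimit_ord (Cardinal.aleph0_le_aleph 1)).succ_lt h

/-- Above every countable ordinal lies one that strictly bounds the values of `h` at pairs of
ordinals below the given one. -/
theorem exists_bound_of_pairs (h : Ordinal → Ordinal → Ordinal) (hh : ∀ a b, h a b < omega1)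
    {γ : Ordinal} (hγ : γ < omega1) :
    ∃ γ' < omega1, γ < γ' ∧ ∀ a < γ, ∀ b < γ, h a b < γ' := by
  have := (countable_Iio_of_lt_omega1 hγ).to_subtype
  let s := ⨆ p : Set.Iio γ × Set.Iio γ, h p.1 p.2
  have hs : s < omega1 := iSup_lt_omega1 fun p => hh _ _
  refine ⟨Order.succ (max γ s), succ_lt_omega1 (max_lt hγ hs),
    Order.lt_succ_of_le (le_max_left _ _), fun a ha b hb => Order.lt_succ_of_le ?_⟩
  exact (Ordinal.le_iSup (fun p : Set.Iio γ × Set.Iio γ => h p.1 p.2)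
    (⟨a, ha⟩, ⟨b, hb⟩)).trans (le_max_right _ _)

/-- The countable ordinals closed under a binary function with countable values form a club. -/
theorem isClub_closed_under (h : Ordinal → Ordinal → Ordinal) (hh : ∀ a b, h a b < omega1) :
    IsClub {δ | δ < omega1 ∧ ∀ a < δ, ∀ b < δ, h a b < δ} := by
  refine ⟨fun δ hδ => hδ.1, fun α hα => ?_, fun s hs _ hlt => ⟨hlt, fun a ha b hb => ?_⟩⟩
  · choose! F hF_lt hF_gt hF using fun γ => exists_bound_of_pairs h hh (γ := γ)
    let u : ℕ → Ordinal := fun n => F^[n] α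
    have u_succ (n : ℕ) : u (n + 1) = F (u n) := Function.iterate_succ_apply' F n α
    have u_lt (n : ℕ) : u n < omega1 := by
      induction n with
      | zero => exact hα
      | succ n ih => rw [u_succ]; exact hF_lt _ ih
    have u_mono : Monotone u := monotone_nat_of_le_succ fun n => by
      rw [u_succ]; exact (hF_gt _ (u_lt n)).le
    refine ⟨⨆ n, u n, ⟨iSup_lt_omega1 u_lt, fun a ha b hb => ?_⟩, Ordinal.le_iSup u 0⟩
    obtain ⟨m, hm⟩ := Ordinal.lt_iSup_iff.1 ha
    obtain ⟨n, hn⟩ := Ordinal.lt_iSup_iff.1 hb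
    have hlt := hF _ (u_lt (max m n)) a (hm.trans_le (u_mono (le_max_left m n))) b
      (hn.trans_le (u_mono (le_max_right m n)))
    rw [← u_succ] at hlt
    exact hlt.trans_le (Ordinal.le_iSup u _)
  · obtain ⟨c, hc, hac⟩ := exists_lt_of_lt_csSup' (max_lt ha hb)
    have hlt := (hs hc).2 a ((le_max_left a b).trans_lt hac) b ((le_max_right a b).trans_lt hac)
    exact hlt.trans_le (le_csSup ⟨omega1, fun d hd => (hs hd).1.le⟩ hc)

/-- If predense subsets of `P` stay predense in `Q`, every element of `Q` has a reduction
to `P`. -/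
theorem OrdPreorder.exists_reduction (Q : OrdPreorder) {P : Set Ordinal} (hPQ : P ⊆ Q.carrier)
    (hpre : ∀ X ⊆ P, Q.PredenseIn P X → Q.PredenseIn Q.carrier X)
    {q : Ordinal} (hq : q ∈ Q.carrier) :
    ∃ p ∈ P, ∀ r ∈ P, Q.le p r → Q.CompatIn Q.carrier r q := by
  by_contra! hcon
  obtain ⟨x, hx, hxq⟩ := hpre {r ∈ P | ¬ Q.CompatIn Q.carrier r q} (fun r hr => hr.1)
    (fun p hp => by
      obtain ⟨r, hr, hpr, hrq⟩ := hcon p hp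
      exact ⟨r, ⟨hr, hrq⟩, r, hr, Q.refl r (hPQ hr), hpr⟩) q hq
  exact hx.2 hxq

/-- if `P` is a suborder of `Q` (a preorder on a set of countable
ordinals) all of whose predense subsets stay predense in `Q`, then on a club of
`δ < ω₁`, predensity in `P↾δ` implies predensity in `Q↾δ`. -/
theorem statement1 (Q : OrdPreorder) (hQ : Q.carrier ⊆ Set.Iio omega1)
    (P : Set Ordinal) (hPQ : P ⊆ Q.carrier)
    (hsub : ∀ p ∈ P, ∀ q ∈ P, Q.CompatIn Q.carrier p q → Q.CompatIn P p q)
    (hpre : ∀ X ⊆ P, Q.PredenseIn P X → Q.PredenseIn Q.carrier X) :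
    ∃ E : Set Ordinal, IsClub E ∧ ∀ δ ∈ E, ∀ X ⊆ P ∩ Set.Iio δ,
      Q.PredenseIn (P ∩ Set.Iio δ) X → Q.PredenseIn (Q.carrier ∩ Set.Iio δ) X := by
  have red (q : Ordinal) : ∃ p < omega1, q ∈ Q.carrier →
      p ∈ P ∧ ∀ r ∈ P, Q.le p r → Q.CompatIn Q.carrier r q := by
    by_cases hq : q ∈ Q.carrier
    · obtain ⟨p, hp, h⟩ := Q.exists_reduction hPQ hpre hq
      exact ⟨p, hQ (hPQ hp), fun _ => ⟨hp, h⟩⟩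
    · exact ⟨0, Cardinal.lt_ord.2 (by simp), fun h => absurd h hq⟩
  have amalg (p q : Ordinal) : ∃ r < omega1, Q.CompatIn Q.carrier p q →
      r ∈ Q.carrier ∧ Q.le p r ∧ Q.le q r := by
    by_cases hpq : Q.CompatIn Q.carrier p q
    · obtain ⟨r, hr, h⟩ := hpq
      exact ⟨r, hQ hr, fun _ => ⟨hr, h⟩⟩
    · exact ⟨0, Cardinal.lt_ord.2 (by simp), fun h => absurd h hpq⟩
  choose f hf_lt hf using red
  choose g hg_lt hg using amalg
  refine ⟨_, isClub_closed_under (fun a b => max (f a) (g a b))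
    fun a b => max_lt (hf_lt a) (hg_lt a b), ?_⟩
  rintro δ ⟨-, hδ⟩ X - hX q ⟨hq, hqδ⟩
  obtain ⟨hfP, hfq⟩ := hf q hq
  obtain ⟨x, hxX, r, ⟨hrP, hrδ⟩, hxr, hfr⟩ :=
    hX (f q) ⟨hfP, (le_max_left _ _).trans_lt (hδ q hqδ q hqδ)⟩
  obtain ⟨hgQ, hrg, hqg⟩ := hg r q (hfq r hrP hfr)
  exact ⟨x, hxX, g r q, ⟨hgQ, (le_max_right _ _).trans_lt (hδ r hrδ q hqδ)⟩,
    Q.trans _ _ _ hxr hrg, hqg⟩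

end Stmt1
end

section
/- Let P be a preorder whose universe is a set of countable ordinals and let X ⊆ P be predense in P. Then the set {δ < ω₁ : X ∩ δ is predense in P↾δ} contains a club of ω₁. -/
namespace Stmt2

/-- The first uncountable ordinal. -/
noncomputable def omega1 : Ordinal := (Cardinal.aleph 1).ord

/-- `C` is a club subset of `ω₁`: unbounded in `ω₁` and closed under suprema of its
bounded nonempty subsets. -/
def IsClub (C : Set Ordinal) : Prop :=
  C ⊆ Set.Iio omega1 ∧
  (∀ α < omega1, ∃ β ∈ C, α ≤ β) ∧
  ∀ s ⊆ C, s.Nonempty → sSup s < omega1 → sSup s ∈ C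

/-- A preorder whose universe is a set of ordinals. -/
structure OrdPreorder where
  carrier : Set Ordinal
  le : Ordinal → Ordinal → Prop
  refl : ∀ p ∈ carrier, le p p
  trans : ∀ p q r : Ordinal, le p q → le q r → le p r

/-- `p` and `q` are compatible within the subset `A` of the universe. -/
def OrdPreorder.CompatIn (P : OrdPreorder) (A : Set Ordinal) (p q : Ordinal) : Prop :=
  ∃ r ∈ A, P.le p r ∧ P.le q r

/-- `X` is predense in the suborder with universe `A`. -/
def OrdPreorder.PredenseIn (P : OrdPreorder) (A X : Set Ordinal) : Prop :=
  ∀ p ∈ A, ∃ x ∈ X, P.CompatIn A x p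

/-- Every initial segment determined by a countable ordinal is countable. -/
theorem countable_Iio_of_lt_omega1 {α : Ordinal} (hα : α < omega1) :
    Countable (Set.Iio α) := by
  rw [← Cardinal.mk_le_aleph0_iff, Cardinal.mk_Iio_ordinal, Cardinal.lift_le_aleph0]
  rw [omega1, Cardinal.lt_ord, ← Cardinal.succ_aleph0, Order.lt_succ_iff] at hα
  exact hα

/-- A countable supremum of countable ordinals is countable. -/
theorem iSup_lt_omega1 {ι : Type*} [Countable ι] {f : ι → Ordinal}
    (hf : ∀ i, f i < omega1) : ⨆ i, f i < omega1 := by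
  rw [omega1, Cardinal.ord_aleph] at *
  exact Ordinal.iSup_lt_omega_one hf

/-- Above every countable ordinal there is a countable ordinal closed under a given function. -/
theorem exists_closed_ge {f : Ordinal → Ordinal} (hf : ∀ p < omega1, f p < omega1)
    {α : Ordinal} (hα : α < omega1) :
    ∃ δ < omega1, α ≤ δ ∧ ∀ p < δ, f p < δ := by
  let F : Ordinal → Ordinal := fun β ↦ ⨆ p : Set.Iio β, Order.succ (f p)
  have hlim : Order.IsSuccLimit omega1 :=
    Cardinal.isSuccLimit_ord (Cardinal.aleph0_le_aleph 1)
  have hF (β) (hβ : β < omega1) : F β < omega1 := by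
    have := countable_Iio_of_lt_omega1 hβ
    exact iSup_lt_omega1 fun p ↦ hlim.succ_lt (hf p (p.2.trans hβ))
  have hiter (n : ℕ) : F^[n] α < omega1 := by
    induction n with
    | zero => exact hα
    | succ n ih => rw [Function.iterate_succ_apply']; exact hF _ ih
  refine ⟨⨆ n : ℕ, F^[n] α, iSup_lt_omega1 hiter, Ordinal.le_iSup (fun n : ℕ ↦ F^[n] α) 0, ?_⟩
  intro p hp
  obtain ⟨n, hn⟩ := Ordinal.lt_iSup_iff.1 hp
  have hfp : f p < F (F^[n] α) :=
    (Order.lt_succ (f p)).trans_le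
      (Ordinal.le_iSup (fun q : Set.Iio (F^[n] α) ↦ Order.succ (f q)) ⟨p, hn⟩)
  rw [← Function.iterate_succ_apply' F] at hfp
  exact hfp.trans_le (Ordinal.le_iSup (fun n : ℕ ↦ F^[n] α) (n + 1))

/-- if `X` is predense in a preorder `P` on a set of countable ordinals,
then the set of `δ < ω₁` such that `X ∩ δ` is predense in `P↾δ` contains a club. -/
theorem statement2 (P : OrdPreorder) (hP : P.carrier ⊆ Set.Iio omega1)
    (X : Set Ordinal) (hX : X ⊆ P.carrier)
    (hpred : P.PredenseIn P.carrier X) :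
    ∃ E : Set Ordinal, IsClub E ∧
      E ⊆ {δ | δ < omega1 ∧
        P.PredenseIn (P.carrier ∩ Set.Iio δ) (X ∩ Set.Iio δ)} := by
  refine ⟨_, ?_, subset_rfl⟩
  refine ⟨fun δ hδ ↦ hδ.1, fun α hα ↦ ?_, fun s hs hne hsup ↦ ⟨hsup, ?_⟩⟩
  · have hbound (p : Ordinal) : ∃ b < omega1, p ∈ P.carrier →
        ∃ x ∈ X, x ≤ b ∧ ∃ r ∈ P.carrier, r ≤ b ∧ P.le x r ∧ P.le p r := by
      by_cases hp : p ∈ P.carrier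
      · obtain ⟨x, hx, r, hr, hxr, hpr⟩ := hpred p hp
        exact ⟨max x r, max_lt (hP (hX hx)) (hP hr), fun _ ↦
          ⟨x, hx, le_max_left _ _, r, hr, le_max_right _ _, hxr, hpr⟩⟩
      · exact ⟨α, hα, fun h ↦ absurd h hp⟩
    choose f hf hwit using hbound
    obtain ⟨δ, hδ, hαδ, hclosed⟩ := exists_closed_ge (fun p _ ↦ hf p) hα
    refine ⟨δ, ⟨hδ, fun p hp ↦ ?_⟩, hαδ⟩
    obtain ⟨x, hx, hxb, r, hr, hrb, hxr, hpr⟩ := hwit p hp.1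
    have hb := hclosed p hp.2
    exact ⟨x, ⟨hx, hxb.trans_lt hb⟩, r, ⟨hr, hrb.trans_lt hb⟩, hxr, hpr⟩
  · rintro p ⟨hp, hlt⟩
    obtain ⟨ε, hε, hpε⟩ := exists_lt_of_lt_csSup hne hlt
    have hle : ε ≤ sSup s := le_csSup ⟨omega1, fun η hη ↦ (hs hη).1.le⟩ hε
    obtain ⟨x, hx, r, hr, hxr, hpr⟩ := (hs hε).2 p ⟨hp, hpε⟩
    exact ⟨x, ⟨hx.1, hx.2.trans_le hle⟩, r, ⟨hr.1, hr.2.trans_le hle⟩, hxr, hpr⟩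

end Stmt2
end

section
/- Let Q be a preorder, P a suborder of Q, q ∈ Q, and A a maximal antichain of P such that every a ∈ A either is incompatible with q in Q, or satisfies: every p ∈ P with a ≤ p is compatible with q in Q. Suppose r ∈ P is such that every p ∈ P with r ≤ p is compatible with q in Q. Then the set {a ∈ A : a is compatible with q in Q} is predense above r in P, i.e., every p ∈ P with r ≤ p is compatible in P with some a ∈ A which is compatible with q in Q. -/
namespace Stmt5

variable {Q : Type*} [Preorder Q]

/-- `p` and `q` are compatible in `Q`: they have a common upper bound in `Q`. -/
def Compat (p q : Q) : Prop := ∃ r, p ≤ r ∧ q ≤ r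

/-- `p` and `q` are compatible in the suborder `P`: a common upper bound lies in `P`. -/
def CompatIn (P : Set Q) (p q : Q) : Prop := ∃ r ∈ P, p ≤ r ∧ q ≤ r

/-- `X` is predense in the suborder `P`. -/
def PredenseIn (P X : Set Q) : Prop := ∀ p ∈ P, ∃ x ∈ X, CompatIn P x p

/-- `P` is a suborder of `Q`: two elements of `P` are compatible in `P`
iff they are compatible in `Q` (the nontrivial direction). -/
def Suborder (P : Set Q) : Prop := ∀ p ∈ P, ∀ q ∈ P, Compat p q → CompatIn P p q

/-- `A` is an antichain of the suborder `P`. -/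
def IsAntichainIn (P A : Set Q) : Prop :=
  A ⊆ P ∧ A.Pairwise fun a b => ¬ CompatIn P a b

/-- if every member of a maximal antichain `A` of `P` satisfies the
reduction dichotomy with respect to `q`, and every extension of `r ∈ P` in `P` is
compatible with `q` in `Q`, then the members of `A` compatible with `q` form a set
predense above `r` in `P`. -/
theorem statement5 (P : Set Q) (hsub : Suborder P) (q : Q)
    (A : Set Q) (hA : IsAntichainIn P A) (hmax : PredenseIn P A)
    (hdich : ∀ a ∈ A, ¬ Compat a q ∨ ∀ p ∈ P, a ≤ p → Compat p q)
    (r : Q) (hr : r ∈ P) (hrq : ∀ p ∈ P, r ≤ p → Compat p q) :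
    ∀ p ∈ P, r ≤ p → ∃ a ∈ A, Compat a q ∧ CompatIn P p a := by
  intro p hp hrp
  obtain ⟨a, ha, s, hs, has, hps⟩ := hmax p hp
  obtain ⟨t, hst, hqt⟩ := hrq s hs (hrp.trans hps)
  exact ⟨a, ha, ⟨t, has.trans hst, hqt⟩, s, hs, hps, has⟩

end Stmt5
end

section
/- Let ζ be a nonzero ordinal with ζ < ω₂, let S ⊆ ω₁, and for each i < ζ let ⟨A^i_δ : δ ∈ S_i⟩ be an oracle trace on a stationary set S_i ⊆ ω₁ such that: (a) S_i ∖ S is nonstationary for every i < ζ; and (b) for all i < j < ζ, the set {δ ∈ S_i : either δ ∉ S_j, or δ ∈ S_j and A^i_δ ≠ A^j_δ} is nonstationary. Then S is stationary and there is an oracle trace ⟨A_δ : δ ∈ S⟩ on S such that for every i < ζ the set {δ ∈ S_i : either δ ∉ S, or δ ∈ S and A^i_δ ≠ A_δ} is nonstationary. -/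
namespace Stmt9

/-- The first uncountable ordinal. -/
noncomputable def omega1 : Ordinal := (Cardinal.aleph 1).ord

/-- The second uncountable ordinal. -/
noncomputable def omega2 : Ordinal := (Cardinal.aleph 2).ord

/-- `C` is a club subset of `ω₁`: unbounded in `ω₁` and closed under suprema of its
bounded nonempty subsets. -/
def IsClub (C : Set Ordinal) : Prop :=
  C ⊆ Set.Iio omega1 ∧
  (∀ α < omega1, ∃ β ∈ C, α ≤ β) ∧
  ∀ s ⊆ C, s.Nonempty → sSup s < omega1 → sSup s ∈ C

/-- `S` is stationary in `ω₁`: it meets every club. -/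
def IsStationary (S : Set Ordinal) : Prop := ∀ C : Set Ordinal, IsClub C → (S ∩ C).Nonempty

/-- `A` is an oracle trace on the stationary set `S ⊆ ω₁`. -/
def OracleTrace (S : Set Ordinal) (A : Ordinal → Set (Set Ordinal)) : Prop :=
  S ⊆ Set.Iio omega1 ∧ IsStationary S ∧
  (∀ δ ∈ S, (A δ).Countable ∧ ∀ Z ∈ A δ, Z ⊆ Set.Iio δ) ∧
  ∀ X : Set Ordinal, IsStationary {δ | δ ∈ S ∧ X ∩ Set.Iio δ ∈ A δ}

universe u v

theorem iSup_lt_omega1 {ι : Type*} [Countable ι] {f : ι → Ordinal} (h : ∀ i, f i < omega1) :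
    ⨆ i, f i < omega1 := by
  rw [omega1, Cardinal.ord_aleph] at *
  exact Ordinal.iSup_lt_omega_one h

theorem countable_Iio {δ : Ordinal} (h : δ < omega1) : (Set.Iio δ).Countable := by
  rw [omega1, Cardinal.lt_ord, ← Cardinal.succ_aleph0, Order.lt_succ_iff] at h
  rw [← Cardinal.le_aleph0_iff_set_countable, Cardinal.mk_Iio_ordinal]
  simpa [← Ordinal.lift_card] using h

theorem add_one_lt_omega1 {δ : Ordinal} (h : δ < omega1) : δ + 1 < omega1 := by
  rw [omega1] at *
  exact (Cardinal.isSuccLimit_ord (Cardinal.aleph0_le_aleph 1)).add_one_lt h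

theorem one_lt_omega1 : 1 < omega1 := by
  rw [omega1, Cardinal.lt_ord]
  simp

theorem isClub_Iio : IsClub (Set.Iio omega1) :=
  ⟨subset_rfl, fun α hα => ⟨α, hα, le_rfl⟩, fun _ _ _ h => h⟩

/-- A single countable ordinal bounds, for all indices below `δ`, a point of `F α β` that is at
least `δ`. -/
theorem exists_bound_above {F : Ordinal → Ordinal → Set Ordinal} (hF : ∀ α β, IsClub (F α β))
    {δ : Ordinal} (hδ : δ < omega1) :
    ∃ γ < omega1, δ < γ ∧ ∀ α < δ, ∀ β < δ, ∃ x ∈ F α β, δ ≤ x ∧ x ≤ γ := by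
  choose p hp hδp using fun α β => (hF α β).2.1 δ hδ
  have := (countable_Iio hδ).to_subtype
  let f : Set.Iio δ × Set.Iio δ → Ordinal := fun q => p q.1 q.2
  have hf : ⨆ q, f q < omega1 := iSup_lt_omega1 fun q => (hF _ _).1 (hp _ _)
  refine ⟨max (δ + 1) (⨆ q, f q), max_lt (add_one_lt_omega1 hδ) hf,
    lt_max_of_lt_left (lt_add_one δ), fun α hα β hβ => ⟨p α β, hp α β, hδp α β, ?_⟩⟩
  exact le_max_of_le_right (Ordinal.le_iSup f (⟨α, hα⟩, ⟨β, hβ⟩))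

theorem isClub_diagonal {F : Ordinal → Ordinal → Set Ordinal} (hF : ∀ α β, IsClub (F α β))
    {θ : Ordinal} (hθ : θ < omega1) :
    IsClub {δ | δ < omega1 ∧ θ < δ ∧ ∀ α < δ, ∀ β < δ, δ ∈ F α β} := by
  refine ⟨fun δ h => h.1, fun α₀ hα₀ => ?_, fun s hs hne hlt => ?_⟩
  · choose! g hg hlt hgF using fun (δ : Ordinal) (hδ : δ < omega1) => exists_bound_above hF hδ
    let d : ℕ → Ordinal := fun n => g^[n] (max α₀ θ)
    have hd : ∀ n, d n < omega1 := fun n => by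
      induction n with
      | zero => exact max_lt hα₀ hθ
      | succ n ih =>
        simp only [d, Function.iterate_succ_apply']
        exact hg _ ih
    have hsucc : ∀ n, d (n + 1) = g (d n) := fun n => Function.iterate_succ_apply' g n _
    have hmono : StrictMono d := strictMono_nat_of_lt_succ fun n => by
      rw [hsucc]
      exact hlt _ (hd n)
    have hsup : ⨆ n, d n < omega1 := iSup_lt_omega1 hd
    have hdlt : ∀ n, d n < ⨆ n, d n := fun n =>
      (hmono (Nat.lt_succ_self n)).trans_le (Ordinal.le_iSup d (n + 1))
    refine ⟨⨆ n, d n, ⟨hsup, (le_max_right α₀ θ).trans_lt (hdlt 0), fun α hα β hβ => ?_⟩,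
      (le_max_left α₀ θ).trans (hdlt 0).le⟩
    obtain ⟨m, hm⟩ := Ordinal.lt_iSup_iff.1 (max_lt hα hβ)
    have hex : ∀ n, ∃ x ∈ F α β, d (m + n) ≤ x ∧ x ≤ d (m + n + 1) := fun n => by
      have hmn : max α β < d (m + n) := hm.trans_le (hmono.monotone (Nat.le_add_right m n))
      rw [hsucc]
      exact hgF _ (hd _) _ ((le_max_left _ _).trans_lt hmn) _ ((le_max_right _ _).trans_lt hmn)
    choose x hxF hdx hxd using hex
    have heq : sSup (Set.range x) = ⨆ n, d n := by
      refine le_antisymm (Ordinal.iSup_le fun n => (hxd n).trans (Ordinal.le_iSup d _))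
        (Ordinal.iSup_le fun n => ?_)
      exact (hmono.monotone (Nat.le_add_left n m)).trans
        ((hdx n).trans (Ordinal.le_iSup x n))
    rw [← heq]
    exact (hF α β).2.2 _ (Set.range_subset_iff.2 hxF) (Set.range_nonempty x) (heq ▸ hsup)
  · have hbdd : BddAbove s := ⟨omega1, fun x hx => (hs hx).1.le⟩
    obtain ⟨y, hy⟩ := hne
    refine ⟨hlt, (hs hy).2.1.trans_le (le_csSup hbdd hy), fun α hα β hβ => ?_⟩
    obtain ⟨z, hz, hαβ⟩ := exists_lt_of_lt_csSup ⟨y, hy⟩ (max_lt hα hβ)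
    have heq : sSup {x ∈ s | max α β < x} = sSup s := by
      refine le_antisymm (csSup_le_csSup hbdd ⟨z, hz, hαβ⟩ fun x hx => hx.1)
        (csSup_le ⟨y, hy⟩ fun x hx => ?_)
      have hb : BddAbove {x ∈ s | max α β < x} := hbdd.mono fun x hx => hx.1
      rcases lt_or_ge (max α β) x with h | h
      · exact le_csSup hb ⟨hx, h⟩
      · exact (h.trans hαβ.le).trans (le_csSup hb ⟨hz, hαβ⟩)
    rw [← heq]
    refine (hF α β).2.2 _ (fun x hx => ?_) ⟨z, hz, hαβ⟩ (heq ▸ hlt)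
    exact (hs hx.1).2.2 α ((le_max_left _ _).trans_lt hx.2) β ((le_max_right _ _).trans_lt hx.2)

theorem IsStationary.mono {S T : Set Ordinal} (hS : IsStationary S) (h : S ⊆ T) :
    IsStationary T := fun C hC => (hS C hC).mono (Set.inter_subset_inter_left C h)

theorem IsStationary.inter_isClub {S C : Set Ordinal} (hS : IsStationary S) (hC : IsClub C) :
    IsStationary (S ∩ C) := by
  intro D hD
  obtain ⟨δ, hδS, -, h1, hδ⟩ := hS _ (isClub_diagonal
    (F := fun α _ => if α = 0 then C else D) (fun α _ => by split_ifs <;> assumption)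
    one_lt_omega1)
  have h0 : (0 : Ordinal) < δ := zero_lt_one.trans h1
  exact ⟨δ, ⟨hδS, by simpa using hδ 0 h0 0 h0⟩, by simpa using hδ 1 h1 0 h0⟩

theorem exists_isClub_disjoint {S : Set Ordinal} (hS : ¬ IsStationary S) :
    ∃ C, IsClub C ∧ ∀ δ ∈ C, δ ∉ S := by
  simp only [IsStationary, not_forall] at hS
  obtain ⟨C, hC, h⟩ := hS
  exact ⟨C, hC, fun δ hδ hδS => h ⟨δ, hδS, hδ⟩⟩

theorem exists_enumeration {ζ : Ordinal.{u}} (hζ0 : ζ ≠ 0) (hζ : ζ < omega2) :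
    ∃ e : Ordinal.{v} → Ordinal.{u},
      (∀ α, e α < ζ) ∧ ∀ i < ζ, ∃ α < omega1, e α = i := by
  have hcard : ζ.card ≤ Cardinal.aleph 1 := by
    rw [omega2, Cardinal.lt_ord, ← one_add_one_eq_two, ← Cardinal.succ_aleph,
      Order.lt_succ_iff] at hζ
    exact hζ
  obtain ⟨f⟩ : Nonempty (Set.Iio ζ ↪ Set.Iio omega1.{v}) := by
    rw [← Cardinal.lift_mk_le', Cardinal.mk_Iio_ordinal, Cardinal.mk_Iio_ordinal, omega1,
      Cardinal.card_ord]
    simpa [← Ordinal.lift_card] using hcard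
  have : Nonempty (Set.Iio ζ) := ⟨⟨0, pos_iff_ne_zero.2 hζ0⟩⟩
  classical
  refine ⟨fun α => (if h : α < omega1 then Function.invFun f ⟨α, h⟩ else
    Classical.arbitrary (Set.Iio ζ) : Set.Iio ζ),
    fun α => Subtype.prop _, fun i hi => ⟨f ⟨i, hi⟩, (f ⟨i, hi⟩).2, ?_⟩⟩
  have h : (f ⟨i, hi⟩ : Ordinal) < omega1 := (f ⟨i, hi⟩).2
  simp only [h, dite_true]
  exact congrArg Subtype.val (Function.leftInverse_invFun f.injective ⟨i, hi⟩)

/-- a `≤`-increasing sequence of oracle traces of length `ζ < ω₂`,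
all of whose domains are almost contained in `S`, has an upper bound which is an
oracle trace on `S`; in particular `S` is stationary. -/
theorem statement9 (ζ : Ordinal) (hζ0 : ζ ≠ 0) (hζ : ζ < omega2)
    (S : Set Ordinal) (hS : S ⊆ Set.Iio omega1)
    (Si : Ordinal → Set Ordinal) (Ai : Ordinal → Ordinal → Set (Set Ordinal))
    (htr : ∀ i < ζ, OracleTrace (Si i) (Ai i))
    (ha : ∀ i < ζ, ¬ IsStationary (Si i \ S))
    (hb : ∀ i < ζ, ∀ j < ζ, i < j →
      ¬ IsStationary {δ | δ ∈ Si i ∧ (δ ∉ Si j ∨ (δ ∈ Si j ∧ Ai i δ ≠ Ai j δ))}) :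
    IsStationary S ∧ ∃ A : Ordinal → Set (Set Ordinal), OracleTrace S A ∧
      ∀ i < ζ, ¬ IsStationary {δ | δ ∈ Si i ∧ (δ ∉ S ∨ (δ ∈ S ∧ Ai i δ ≠ A δ))} := by
  obtain ⟨e, heζ, hesurj⟩ := exists_enumeration hζ0 hζ
  have hclub : ∀ α β, ∃ C, IsClub C ∧ ∀ δ ∈ C,
      (α = β → δ ∈ Si (e α) → δ ∈ S) ∧
      (e α < e β → δ ∈ Si (e α) → δ ∈ Si (e β) → Ai (e α) δ = Ai (e β) δ) := by
    intro α β
    rcases eq_or_ne α β with rfl | hne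
    · obtain ⟨C, hC, h⟩ := exists_isClub_disjoint (ha _ (heζ α))
      refine ⟨C, hC, fun δ hδ => ⟨fun _ hi => ?_, fun hlt => absurd hlt (lt_irrefl _)⟩⟩
      by_contra hS'
      exact h δ hδ ⟨hi, hS'⟩
    by_cases hlt : e α < e β
    · obtain ⟨C, hC, h⟩ := exists_isClub_disjoint (hb _ (heζ α) _ (heζ β) hlt)
      refine ⟨C, hC, fun δ hδ => ⟨fun heq => absurd heq hne, fun _ hi hj => ?_⟩⟩
      by_contra hA
      exact h δ hδ ⟨hi, .inr ⟨hj, hA⟩⟩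
    · exact ⟨_, isClub_Iio, fun δ _ => ⟨fun heq => absurd heq hne, fun h => absurd h hlt⟩⟩
  choose F hF hFS using hclub
  let A : Ordinal → Set (Set Ordinal) := fun δ =>
    ⋃ α ∈ {α | α < δ ∧ δ ∈ Si (e α)}, Ai (e α) δ
  have hagree : ∀ i < ζ, ∃ C, IsClub C ∧ ∀ δ ∈ C, δ ∈ Si i → δ ∈ S ∧ Ai i δ = A δ := by
    intro i hi
    obtain ⟨θ, hθ, rfl⟩ := hesurj i hi
    refine ⟨_, isClub_diagonal hF hθ, fun δ ⟨_, hθδ, hδ⟩ hδi =>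
      ⟨(hFS θ θ δ (hδ θ hθδ θ hθδ)).1 rfl hδi, ?_⟩⟩
    refine Set.Subset.antisymm (Set.subset_biUnion_of_mem (u := fun α => Ai (e α) δ)
      (show θ ∈ {α | α < δ ∧ δ ∈ Si (e α)} from ⟨hθδ, hδi⟩)) (Set.iUnion₂_subset ?_)
    rintro β ⟨hβδ, hδβ⟩
    rcases lt_trichotomy (e θ) (e β) with h | h | h
    · exact ((hFS θ β δ (hδ θ hθδ β hβδ)).2 h hδi hδβ).ge
    · rw [h]
    · exact ((hFS β θ δ (hδ β hβδ θ hθδ)).2 h hδβ hδi).le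
  have hguess : ∀ X : Set Ordinal, IsStationary {δ | δ ∈ S ∧ X ∩ Set.Iio δ ∈ A δ} := by
    intro X
    have h0 : 0 < ζ := pos_iff_ne_zero.2 hζ0
    obtain ⟨C, hC, h⟩ := hagree 0 h0
    refine (((htr 0 h0).2.2.2 X).inter_isClub hC).mono ?_
    rintro δ ⟨⟨hδ, hX⟩, hδC⟩
    obtain ⟨hδS, hA⟩ := h δ hδC hδ
    exact ⟨hδS, hA ▸ hX⟩
  have hstat : IsStationary S := (hguess ∅).mono fun δ h => h.1
  refine ⟨hstat, A, ⟨hS, hstat, fun δ hδ => ⟨?_, fun Z hZ => ?_⟩, hguess⟩, fun i hi hbad => ?_⟩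
  · exact ((countable_Iio (hS hδ)).mono fun α h => h.1).biUnion fun α h =>
      ((htr _ (heζ α)).2.2.1 δ h.2).1
  · obtain ⟨α, h, hZ⟩ := Set.mem_iUnion₂.1 hZ
    exact ((htr _ (heζ α)).2.2.1 δ h.2).2 Z hZ
  · obtain ⟨C, hC, h⟩ := hagree i hi
    obtain ⟨δ, ⟨hδi, hδ⟩, hδC⟩ := hbad C hC
    obtain ⟨hδS, hA⟩ := h δ hδC hδi
    exact hδ.elim (fun hn => hn hδS) fun hn => hn.2 hA

end Stmt9
end

section
/- Let S ⊆ ω₁ be stationary and let ⟨A_δ : δ ∈ S⟩ be a section-closed oracle trace. Then for every Y ⊆ ω₁ the set I_Y = {δ ∈ S : Y ∩ δ ∈ A_δ} is D_A-positive, i.e., ω₁ ∖ I_Y ∉ D_A. In particular S itself is D_A-positive (S ∈ D_A⁺). -/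
namespace Stmt11

/-- The first uncountable ordinal. -/
noncomputable def omega1 : Ordinal := (Cardinal.aleph 1).ord

/-- `C` is a club subset of `ω₁`: unbounded in `ω₁` and closed under suprema of its
bounded nonempty subsets. -/
def IsClub (C : Set Ordinal) : Prop :=
  C ⊆ Set.Iio omega1 ∧
  (∀ α < omega1, ∃ β ∈ C, α ≤ β) ∧
  ∀ s ⊆ C, s.Nonempty → sSup s < omega1 → sSup s ∈ C

/-- `S` is stationary in `ω₁`: it meets every club. -/
def IsStationary (S : Set Ordinal) : Prop := ∀ C : Set Ordinal, IsClub C → (S ∩ C).Nonempty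

/-- `A` is an oracle trace on the stationary set `S ⊆ ω₁`. -/
def OracleTrace (S : Set Ordinal) (A : Ordinal → Set (Set Ordinal)) : Prop :=
  S ⊆ Set.Iio omega1 ∧ IsStationary S ∧
  (∀ δ ∈ S, (A δ).Countable ∧ ∀ Z ∈ A δ, Z ⊆ Set.Iio δ) ∧
  ∀ X : Set Ordinal, IsStationary {δ | δ ∈ S ∧ X ∩ Set.Iio δ ∈ A δ}

/-- The filter `D_A` associated to an oracle trace. -/
def DA (S : Set Ordinal) (A : Ordinal → Set (Set Ordinal)) : Set (Set Ordinal) :=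
  {X | X ⊆ Set.Iio omega1 ∧ ∃ Y E : Set Ordinal, IsClub E ∧
    {δ | δ ∈ S ∧ δ ∈ E ∧ Y ∩ Set.Iio δ ∈ A δ} ⊆ X}

/-- The (inverse) pairing function `pr = e⁻¹` maps `δ × δ` onto `δ`. -/
def PairBelow (pr : Ordinal → Ordinal → Ordinal) (δ : Ordinal) : Prop :=
  (∀ α < δ, ∀ β < δ, pr α β < δ) ∧ ∀ γ < δ, ∃ α < δ, ∃ β < δ, pr α β = γ

/-- `pr` is (the inverse of) a bijection `e : ω₁ → ω₁ × ω₁` such that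
`E₀ = {δ < ω₁ : e maps δ onto δ × δ}` is a club of `ω₁`. -/
def GoodPairing (pr : Ordinal → Ordinal → Ordinal) : Prop :=
  (∀ α < omega1, ∀ β < omega1, pr α β < omega1) ∧
  (∀ α β α' β' : Ordinal, α < omega1 → β < omega1 → α' < omega1 → β' < omega1 →
    pr α β = pr α' β' → α = α' ∧ β = β') ∧
  (∀ γ < omega1, ∃ α < omega1, ∃ β < omega1, pr α β = γ) ∧
  IsClub {δ | δ < omega1 ∧ PairBelow pr δ}

/-- The oracle trace `A` is section-closed. -/
def SectionClosed (pr : Ordinal → Ordinal → Ordinal)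
    (S : Set Ordinal) (A : Ordinal → Set (Set Ordinal)) : Prop :=
  ∀ δ ∈ S, PairBelow pr δ → ∀ Z ∈ A δ, ∀ α < δ,
    ({β | pr α β ∈ Z} ∩ Set.Iio δ) ∈ A δ

theorem IsClub.inter {C D : Set Ordinal} (hC : IsClub C) (hD : IsClub D) : IsClub (C ∩ D) := by
  obtain ⟨hC₁, hC₂, hC₃⟩ := hC
  obtain ⟨hD₁, hD₂, hD₃⟩ := hD
  refine ⟨fun x hx => hC₁ hx.1, fun α hα => ?_, fun s hs hne hlt =>
    ⟨hC₃ s (fun x hx => (hs hx).1) hne hlt, hD₃ s (fun x hx => (hs hx).2) hne hlt⟩⟩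
  choose! g hgC hg using hC₂
  choose! h hhD hh using hD₂
  let a : ℕ → Ordinal := fun n => (fun x => h (g x))^[n] α
  have ha_succ (n : ℕ) : a (n + 1) = h (g (a n)) := Function.iterate_succ_apply' _ _ _
  have ha (n : ℕ) : a n < omega1 := by
    induction n with
    | zero => exact hα
    | succ n ih => rw [ha_succ]; exact hD₁ (hhD _ (hC₁ (hgC _ ih)))
  have hga (n : ℕ) : g (a n) < omega1 := hC₁ (hgC _ (ha n))
  have hle (n : ℕ) : a n ≤ ⨆ n, g (a n) :=
    (hg _ (ha n)).trans (Ordinal.le_iSup (fun n => g (a n)) n)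
  have hlt : ⨆ n, g (a n) < omega1 := by
    rw [omega1, Cardinal.ord_aleph] at hga ⊢
    exact Ordinal.iSup_lt_omega_one hga
  have heq : ⨆ n, h (g (a n)) = ⨆ n, g (a n) := by
    apply le_antisymm
    · exact Ordinal.iSup_le fun n => ha_succ n ▸ hle (n + 1)
    · exact Ordinal.iSup_le fun n =>
        (hh _ (hga n)).trans (Ordinal.le_iSup (fun n => h (g (a n))) n)
  refine ⟨⨆ n, g (a n), ⟨?_, ?_⟩, hle 0⟩
  · exact hC₃ _ (Set.range_subset_iff.2 fun n => hgC _ (ha n)) (Set.range_nonempty _) hlt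
  · rw [← heq] at hlt ⊢
    exact hD₃ _ (Set.range_subset_iff.2 fun n => hhD _ (hga n)) (Set.range_nonempty _) hlt

theorem isClub_Ioo {γ : Ordinal} (hγ : γ < omega1) : IsClub (Set.Ioo γ omega1) := by
  refine ⟨fun x hx => hx.2, fun α hα => ⟨Order.succ (max α γ), ⟨?_, ?_⟩, ?_⟩,
    fun s hs ⟨x, hx⟩ hlt => ⟨?_, hlt⟩⟩
  · exact Order.lt_succ_of_le (le_max_right _ _)
  · exact (Cardinal.isSuccLimit_ord (Cardinal.aleph0_le_aleph 1)).succ_lt (max_lt hα hγ)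
  · exact (le_max_left _ _).trans (Order.le_succ _)
  · exact (hs hx).1.trans_le (le_csSup ⟨omega1, fun y hy => (hs hy).2.le⟩ hx)

theorem DA_mono {S : Set Ordinal} {A : Ordinal → Set (Set Ordinal)} {X X' : Set Ordinal}
    (hX : X ∈ DA S A) (h : X ⊆ X') (hX' : X' ⊆ Set.Iio omega1) : X' ∈ DA S A := by
  obtain ⟨-, Y, E, hE, hsub⟩ := hX
  exact ⟨hX', Y, E, hE, hsub.trans h⟩

/-- Two sets are guessed simultaneously at some point of any given club. -/
theorem exists_guess_two {pr : Ordinal → Ordinal → Ordinal} (hpr : GoodPairing pr)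
    {S : Set Ordinal} {A : Ordinal → Set (Set Ordinal)}
    (hA : OracleTrace S A) (hsec : SectionClosed pr S A) (Y Y' : Set Ordinal)
    {E : Set Ordinal} (hE : IsClub E) :
    ∃ δ ∈ S, δ ∈ E ∧ Y ∩ Set.Iio δ ∈ A δ ∧ Y' ∩ Set.Iio δ ∈ A δ := by
  obtain ⟨-, hinj, -, hE₀⟩ := hpr
  have h1 : (1 : Ordinal) < omega1 :=
    Cardinal.lt_ord.2 (by simp)
  have h0 : (0 : Ordinal) < omega1 := zero_lt_one.trans h1
  let Z : Set Ordinal := {γ | ∃ β < omega1, (β ∈ Y ∧ γ = pr 0 β) ∨ (β ∈ Y' ∧ γ = pr 1 β)}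
  obtain ⟨δ, ⟨hδS, hδZ⟩, ⟨hδE, hδ, hpb⟩, hδ1, -⟩ :=
    hA.2.2.2 Z _ ((hE.inter hE₀).inter (isClub_Ioo h1))
  have hδ0 : 0 < δ := zero_lt_one.trans hδ1
  have hsec0 : {β | pr 0 β ∈ Z ∩ Set.Iio δ} ∩ Set.Iio δ = Y ∩ Set.Iio δ := by
    ext β
    refine and_congr_left fun hβ => ⟨?_, fun hY => ⟨⟨β, hβ.trans hδ, .inl ⟨hY, rfl⟩⟩,
      hpb.1 _ hδ0 _ hβ⟩⟩
    rintro ⟨⟨β', hβ', ⟨hY, h⟩ | ⟨hY, h⟩⟩, -⟩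
    · rwa [(hinj _ _ _ _ h0 (hβ.trans hδ) h0 hβ' h).2]
    · exact absurd (hinj _ _ _ _ h0 (hβ.trans hδ) h1 hβ' h).1 zero_ne_one
  have hsec1 : {β | pr 1 β ∈ Z ∩ Set.Iio δ} ∩ Set.Iio δ = Y' ∩ Set.Iio δ := by
    ext β
    refine and_congr_left fun hβ => ⟨?_, fun hY => ⟨⟨β, hβ.trans hδ, .inr ⟨hY, rfl⟩⟩,
      hpb.1 _ hδ1 _ hβ⟩⟩
    rintro ⟨⟨β', hβ', ⟨hY, h⟩ | ⟨hY, h⟩⟩, -⟩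
    · exact absurd (hinj _ _ _ _ h1 (hβ.trans hδ) h0 hβ' h).1 one_ne_zero
    · rwa [(hinj _ _ _ _ h1 (hβ.trans hδ) h1 hβ' h).2]
  exact ⟨δ, hδS, hδE, hsec0 ▸ hsec δ hδS hpb _ hδZ 0 hδ0, hsec1 ▸ hsec δ hδS hpb _ hδZ 1 hδ1⟩

/-- for a section-closed oracle trace, every generating set
`I_Y = {δ ∈ S : Y ∩ δ ∈ A δ}` is `D_A`-positive; in particular `S ∈ D_A⁺`. -/
theorem statement11 (pr : Ordinal → Ordinal → Ordinal) (hpr : GoodPairing pr)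
    (S : Set Ordinal) (A : Ordinal → Set (Set Ordinal))
    (hS : IsStationary S) (hA : OracleTrace S A) (hsec : SectionClosed pr S A) :
    (∀ Y : Set Ordinal,
      Set.Iio omega1 \ {δ | δ ∈ S ∧ Y ∩ Set.Iio δ ∈ A δ} ∉ DA S A) ∧
    Set.Iio omega1 \ S ∉ DA S A := by
  have hpos (Y : Set Ordinal) :
      Set.Iio omega1 \ {δ | δ ∈ S ∧ Y ∩ Set.Iio δ ∈ A δ} ∉ DA S A := by
    rintro ⟨-, Y', E, hE, hsub⟩
    obtain ⟨δ, hδS, hδE, hY, hY'⟩ := exists_guess_two hpr hA hsec Y Y' hE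
    exact (hsub ⟨hδS, hδE, hY'⟩).2 ⟨hδS, hY⟩
  exact ⟨hpos, fun h => hpos ∅ (DA_mono h
    (Set.sdiff_subset_sdiff_right fun _ hδ => hδ.1) Set.sdiff_subset)⟩

end Stmt11
end
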